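/- arXiv:1209.6120 — 2 statements merged into one kernel-verified Lean document; each statement's English description precedes it below -/
import Mathlib

section
/- Let (k, m) be a balanced pair and x_0 = k/2^{2m}. Then for every x ∈ [k/2^{2m}, (k+1)/2^{2m}], f_r(x) = f_r(x_0) + 2^{−2m} f_{r′}(2^{2m}(x − x_0)), where r′ = (r_{2m}, r_{2m+1}, r_{2m+2}, …) is the shifted sign sequence. -/
/-- `phi x` is the distance from `x` to the nearest integer. -/
noncomputable def phi (x : ℝ) : ℝ := |x - round x|

/-- The signed Takagi function associated to the sign sequence `r`. -/
noncomputable def takagi (r : ℕ → ℝ) (x : ℝ) : ℝ :=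
  ∑' n : ℕ, r n / 2 ^ n * phi (2 ^ n * x)

/-- `eps n x` is the `n`-th binary digit of `x ∈ [0,1)` (for `n ≥ 1`), using the
terminating expansion for dyadic rationals. -/
noncomputable def eps (n : ℕ) (x : ℝ) : ℕ := (⌊2 ^ n * x⌋ % 2).toNat

/-- `Dfun r k x = ∑_{j=1}^k r_{j-1} (-1)^{ε_j(x)}`. -/
noncomputable def Dfun (r : ℕ → ℝ) (k : ℕ) (x : ℝ) : ℝ :=
  ∑ j ∈ Finset.Icc 1 k, r (j - 1) * (-1 : ℝ) ^ eps j x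

/-- `(k, m)` is a balanced pair if `0 ≤ k < 2^{2m}` and `D_{2m}(k/2^{2m}) = 0`. -/
def BalancedPair (r : ℕ → ℝ) (k m : ℕ) : Prop :=
  k < 2 ^ (2 * m) ∧ Dfun r (2 * m) ((k : ℝ) / 2 ^ (2 * m)) = 0

/-- The generation of a balanced pair `(k, m)`: the number of indices
`1 ≤ j ≤ 2m` with `D_j(k/2^{2m}) = 0`. -/
noncomputable def generation (r : ℕ → ℝ) (k m : ℕ) : ℕ :=
  {j : ℕ | 1 ≤ j ∧ j ≤ 2 * m ∧ Dfun r j ((k : ℝ) / 2 ^ (2 * m)) = 0}.ncard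

theorem phi_add_intCast (x : ℝ) (z : ℤ) : phi (x + z) = phi x := by
  simp [phi]

theorem phi_of_mem_left {x : ℝ} (h0 : 0 ≤ x) (h1 : x ≤ 1 / 2) : phi x = x := by
  rw [phi, abs_sub_round_eq_min, Int.fract_eq_self.2 ⟨h0, by linarith⟩, min_eq_left (by linarith)]

theorem phi_neg (x : ℝ) : phi (-x) = phi x := by
  rw [phi, phi, abs_sub_round_eq_min, abs_sub_round_eq_min]
  by_cases h : Int.fract x = 0
  · rw [h, Int.fract_neg_eq_zero.2 h]
  · rw [Int.fract_neg h, sub_sub_cancel, min_comm]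

theorem phi_of_mem_right {x : ℝ} (h0 : 1 / 2 ≤ x) (h1 : x ≤ 1) : phi x = 1 - x := by
  rw [← phi_of_mem_left (x := 1 - x) (by linarith) (by linarith), ← phi_neg (1 - x),
    ← phi_add_intCast (-(1 - x)) 1]
  congr 1
  push_cast
  ring

/-- `phi` is affine on each half-integer interval, with slope given by the parity of the index. -/
theorem phi_sub_phi_of_mem_Icc {a : ℤ} {y z : ℝ} (hy : (a : ℝ) ≤ 2 * y) (hyz : y ≤ z)
    (hz : 2 * z ≤ a + 1) : phi z = phi y + (-1) ^ (a % 2).toNat * (z - y) := by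
  have shift (w : ℝ) (b : ℤ) : phi w = phi (w - b) := by
    simpa using phi_add_intCast (w - b) b
  rcases Int.even_or_odd' a with ⟨b, rfl | rfl⟩
  · push_cast at hy hz
    rw [shift z b, shift y b, phi_of_mem_left (by linarith) (by linarith),
      phi_of_mem_left (by linarith) (by linarith), Int.mul_emod_right]
    simp
  · push_cast at hy hz
    rw [shift z b, shift y b, phi_of_mem_right (by linarith) (by linarith),
      phi_of_mem_right (by linarith) (by linarith), show (2 * b + 1) % 2 = 1 by omega]
    simp only [Int.toNat_one, pow_one]
    ring

theorem summable_takagi {r : ℕ → ℝ} (hr : ∀ n, r n = 1 ∨ r n = -1) (x : ℝ) :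
    Summable fun n : ℕ => r n / 2 ^ n * phi (2 ^ n * x) := by
  refine Summable.of_norm_bounded summable_geometric_two fun n => ?_
  have h1 : |r n| = 1 := by rcases hr n with h | h <;> simp [h]
  have h2 : |phi (2 ^ n * x)| ≤ 1 := by
    rw [phi, abs_abs]
    linarith [abs_sub_round (2 ^ n * x)]
  rw [Real.norm_eq_abs, abs_mul, abs_div, h1, abs_of_pos (by positivity : (0 : ℝ) < 2 ^ n),
    div_pow, one_pow]
  exact mul_le_of_le_one_right (by positivity) h2

theorem phi_two_pow_mul_of_lt {k N n : ℕ} (hn : n < N) {x : ℝ} (h0 : (k : ℝ) / 2 ^ N ≤ x)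
    (h1 : x ≤ ((k : ℝ) + 1) / 2 ^ N) :
    phi (2 ^ n * x) = phi (2 ^ n * ((k : ℝ) / 2 ^ N)) +
      (-1) ^ eps (n + 1) ((k : ℝ) / 2 ^ N) * (2 ^ n * (x - (k : ℝ) / 2 ^ N)) := by
  obtain ⟨j, rfl⟩ := Nat.exists_eq_add_of_lt hn
  have hk : (2 : ℝ) ^ (n + 1) * ((k : ℝ) / 2 ^ (n + j + 1)) = (k : ℝ) / ((2 ^ j : ℕ) : ℝ) := by
    push_cast
    field_simp
    ring
  have hfloor : ⌊(2 : ℝ) ^ (n + 1) * ((k : ℝ) / 2 ^ (n + j + 1))⌋ = ((k / 2 ^ j : ℕ) : ℤ) := by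
    rw [hk, ← Int.natCast_floor_eq_floor (by positivity), Nat.floor_div_eq_div]
  have hlt : ((k : ℝ) + 1) ≤ (((k / 2 ^ j : ℕ) : ℝ) + 1) * 2 ^ j := by
    have := Nat.lt_mul_of_div_lt (Nat.lt_succ_self (k / 2 ^ j)) (pow_pos two_pos j)
    rw [Nat.lt_iff_add_one_le, Nat.succ_eq_add_one] at this
    exact_mod_cast this
  rw [phi_sub_phi_of_mem_Icc (a := ⌊(2 : ℝ) ^ (n + 1) * ((k : ℝ) / 2 ^ (n + j + 1))⌋)
    (y := 2 ^ n * ((k : ℝ) / 2 ^ (n + j + 1))) (z := 2 ^ n * x), eps, ← mul_sub]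
  · refine (Int.floor_le _).trans_eq ?_
    ring
  · gcongr
  · rw [hfloor, Int.cast_natCast]
    have hx : 2 * (2 ^ n * x) ≤ 2 * (2 ^ n * (((k : ℝ) + 1) / 2 ^ (n + j + 1))) := by gcongr
    refine hx.trans ?_
    have he : 2 * (2 ^ n * (((k : ℝ) + 1) / 2 ^ (n + j + 1))) = ((k : ℝ) + 1) / 2 ^ j := by
      field_simp
      ring
    rw [he, div_le_iff₀ (by positivity)]
    exact hlt

theorem sum_range_takagi (r : ℕ → ℝ) {k N : ℕ} {x : ℝ} (h0 : (k : ℝ) / 2 ^ N ≤ x)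
    (h1 : x ≤ ((k : ℝ) + 1) / 2 ^ N) :
    ∑ n ∈ Finset.range N, r n / 2 ^ n * phi (2 ^ n * x) =
      ∑ n ∈ Finset.range N, r n / 2 ^ n * phi (2 ^ n * ((k : ℝ) / 2 ^ N)) +
        Dfun r N ((k : ℝ) / 2 ^ N) * (x - (k : ℝ) / 2 ^ N) := by
  have hD : Dfun r N ((k : ℝ) / 2 ^ N) =
      ∑ n ∈ Finset.range N, r n * (-1 : ℝ) ^ eps (n + 1) ((k : ℝ) / 2 ^ N) := by
    rw [Dfun, Finset.range_eq_Ico]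
    exact (Finset.sum_Ico_add' (fun j => r (j - 1) * (-1 : ℝ) ^ eps j ((k : ℝ) / 2 ^ N)) 0 N 1).symm
  rw [hD, Finset.sum_mul, ← Finset.sum_add_distrib]
  refine Finset.sum_congr rfl fun n hn => ?_
  rw [phi_two_pow_mul_of_lt (Finset.mem_range.1 hn) h0 h1]
  field_simp

theorem phi_two_pow_add_mul (k N n : ℕ) (x : ℝ) :
    phi (2 ^ (n + N) * x) = phi (2 ^ n * (2 ^ N * (x - (k : ℝ) / 2 ^ N))) := by
  rw [← phi_add_intCast (2 ^ n * (2 ^ N * (x - (k : ℝ) / 2 ^ N))) (2 ^ n * k)]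
  congr 1
  push_cast
  field_simp
  ring

/-- The tail of the Takagi series is a rescaled Takagi function of the shifted signs. -/
theorem tsum_takagi_tail (r : ℕ → ℝ) (k N : ℕ) (x : ℝ) :
    ∑' n : ℕ, r (n + N) / 2 ^ (n + N) * phi (2 ^ (n + N) * x) =
      1 / 2 ^ N * takagi (fun n => r (n + N)) (2 ^ N * (x - (k : ℝ) / 2 ^ N)) := by
  rw [takagi, ← tsum_mul_left]
  refine tsum_congr fun n => ?_
  rw [phi_two_pow_add_mul k]
  field_simp
  ring

theorem takagi_zero (r : ℕ → ℝ) : takagi r 0 = 0 := by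
  simp [takagi, phi]

/-- Above the dyadic interval of a balanced pair `(k, m)`, the graph of `f_r` is
a shifted, rescaled copy of the graph of the signed Takagi function for the
shifted sign sequence `r' = (r_{2m}, r_{2m+1}, …)`. -/
theorem takagi_self_similar_on_balanced (r : ℕ → ℝ) (hr : ∀ n, r n = 1 ∨ r n = -1)
    (k m : ℕ) (hb : BalancedPair r k m) :
    ∀ x ∈ Set.Icc ((k : ℝ) / 2 ^ (2 * m)) (((k : ℝ) + 1) / 2 ^ (2 * m)),
      takagi r x = takagi r ((k : ℝ) / 2 ^ (2 * m)) +
        (1 / 2 ^ (2 * m)) *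
          takagi (fun n => r (n + 2 * m)) (2 ^ (2 * m) * (x - (k : ℝ) / 2 ^ (2 * m))) := by
  intro x hx
  rw [takagi, takagi, ← (summable_takagi hr x).sum_add_tsum_nat_add (2 * m),
    ← (summable_takagi hr ((k : ℝ) / 2 ^ (2 * m))).sum_add_tsum_nat_add (2 * m),
    tsum_takagi_tail r k, tsum_takagi_tail r k, sum_range_takagi r hx.1 hx.2, hb.2,
    sub_self, mul_zero, takagi_zero]
  ring
end

section
/- For each n ≥ 1, the union U_n = ∪ I(k, m), taken over all balanced pairs (k, m) of generation n, has full Lebesgue measure in [0,1] and in particular is dense in [0,1]. -/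
open MeasureTheory

/-- `Un r n` is the union of the intervals `I(k, m) = [k/2^{2m}, (k+1)/2^{2m}]`
over all balanced pairs `(k, m)` of generation `n`. -/
noncomputable def Un (r : ℕ → ℝ) (n : ℕ) : Set ℝ :=
  ⋃ p : ℕ × ℕ, ⋃ _ : BalancedPair r p.1 p.2 ∧ generation r p.1 p.2 = n,
    Set.Icc ((p.1 : ℝ) / 2 ^ (2 * p.2)) (((p.1 : ℝ) + 1) / 2 ^ (2 * p.2))

/-- Doubling before taking the floor and halving afterwards changes nothing. -/
lemma floor_two_pow_succ_ediv (i : ℕ) (x : ℝ) : ⌊2 ^ (i + 1) * x⌋ / 2 = ⌊2 ^ i * x⌋ := by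
  have h := Int.floor_div_natCast ((2 : ℝ) ^ (i + 1) * x) 2
  push_cast at h
  rw [← h]
  congr 1
  ring

lemma eps_floor {j k : ℕ} (hjk : j ≤ k) (x : ℝ) :
    eps j ((⌊2 ^ k * x⌋ : ℝ) / 2 ^ k) = eps j x := by
  obtain ⟨d, rfl⟩ := Nat.exists_eq_add_of_le hjk
  have h₁ : (2 : ℝ) ^ j * ((⌊2 ^ (j + d) * x⌋ : ℝ) / 2 ^ (j + d)) =
      (⌊2 ^ (j + d) * x⌋ : ℝ) / (2 ^ d : ℕ) := by
    push_cast
    field_simp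
    ring
  have h₂ : (2 : ℝ) ^ j * x = (2 ^ (j + d) * x) / (2 ^ d : ℕ) := by
    push_cast
    field_simp
    ring
  unfold eps
  rw [h₁, h₂, Int.floor_div_natCast, Int.floor_div_natCast, Int.floor_intCast]

lemma Dfun_floor (r : ℕ → ℝ) {j k : ℕ} (hjk : j ≤ k) (x : ℝ) :
    Dfun r j ((⌊2 ^ k * x⌋ : ℝ) / 2 ^ k) = Dfun r j x := by
  unfold Dfun
  refine Finset.sum_congr rfl fun i hi => ?_
  rw [eps_floor ((Finset.mem_Icc.1 hi).2.trans hjk)]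

lemma Dfun_succ (r : ℕ → ℝ) (k : ℕ) (x : ℝ) :
    Dfun r (k + 1) x = Dfun r k x + r k * (-1) ^ eps (k + 1) x := by
  unfold Dfun
  rw [Finset.sum_Icc_succ_top (by omega)]
  simp

/-- The walk `Dfun r · x` is integer valued with steps `±1`. -/
lemma exists_int_walk {r : ℕ → ℝ} (hr : ∀ n, r n = 1 ∨ r n = -1) (x : ℝ) :
    ∃ d : ℕ → ℤ, (∀ k, (d k : ℝ) = Dfun r k x) ∧ d 0 = 0 ∧
      ∀ k, d (k + 1) = d k + 1 ∨ d (k + 1) = d k - 1 := by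
  have hstep (k : ℕ) : r k * (-1 : ℝ) ^ eps (k + 1) x = 1 ∨
      r k * (-1 : ℝ) ^ eps (k + 1) x = -1 := by
    rcases hr k with h | h <;> rcases neg_one_pow_eq_or ℝ (eps (k + 1) x) with h' | h' <;>
      simp [h, h']
  have hex (k : ℕ) : ∃ z : ℤ, (z : ℝ) = Dfun r k x := by
    induction k with
    | zero => exact ⟨0, by simp [Dfun]⟩
    | succ k ih =>
      obtain ⟨z, hz⟩ := ih
      rcases hstep k with h | h
      · exact ⟨z + 1, by rw [Dfun_succ, h, ← hz]; push_cast; ring⟩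
      · exact ⟨z - 1, by rw [Dfun_succ, h, ← hz]; push_cast; ring⟩
  choose d hd using hex
  refine ⟨d, hd, ?_, fun k => ?_⟩
  · have h := hd 0
    simpa [Dfun] using h
  · have h := hd (k + 1)
    rw [Dfun_succ, ← hd k] at h
    rcases hstep k with h' | h' <;> rw [h'] at h
    · left
      exact_mod_cast h
    · right
      rw [← sub_eq_add_neg] at h
      exact_mod_cast h

lemma walk_abs_le {d : ℕ → ℤ} (h0 : d 0 = 0)
    (hd : ∀ k, d (k + 1) = d k + 1 ∨ d (k + 1) = d k - 1) (k : ℕ) :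
    -(k : ℤ) ≤ d k ∧ d k ≤ k := by
  induction k with
  | zero => simp [h0]
  | succ k ih =>
    push_cast
    rcases hd k with h | h <;> omega

lemma even_of_walk_eq_zero {d : ℕ → ℤ} (h0 : d 0 = 0)
    (hd : ∀ k, d (k + 1) = d k + 1 ∨ d (k + 1) = d k - 1) {k : ℕ} (hk : d k = 0) : Even k := by
  have h (k : ℕ) : (2 : ℤ) ∣ d k - k := by
    induction k with
    | zero => simp [h0]
    | succ k ih =>
      push_cast
      rcases hd k with h | h <;> omega
  have := h k
  rw [hk] at this
  rw [Nat.even_iff]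
  omega

/-- A walk with steps `±1` that never vanishes after time `N` is bounded on one side. -/
lemma walk_bounded_of_ne_zero {d : ℕ → ℤ} (h0 : d 0 = 0)
    (hd : ∀ k, d (k + 1) = d k + 1 ∨ d (k + 1) = d k - 1) {N : ℕ} (hN : ∀ k, N ≤ k → d k ≠ 0) :
    (∀ k, -(N : ℤ) ≤ d k) ∨ ∀ k, d k ≤ N := by
  have hfar (k : ℕ) (hk : k ≤ N) := walk_abs_le h0 hd k
  rcases lt_or_gt_of_ne (hN N le_rfl) with h | h
  · right
    have hneg (k : ℕ) (hk : N ≤ k) : d k < 0 := by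
      induction k, hk using Nat.le_induction with
      | base => exact h
      | succ k hk ih =>
        have := hN (k + 1) (by omega)
        rcases hd k with h | h <;> omega
    intro k
    rcases le_total k N with hk | hk
    · have := hfar k hk
      omega
    · have := hneg k hk
      omega
  · left
    have hpos (k : ℕ) (hk : N ≤ k) : 0 < d k := by
      induction k, hk using Nat.le_induction with
      | base => exact h
      | succ k hk ih =>
        have := hN (k + 1) (by omega)
        rcases hd k with h | h <;> omega
    intro k
    rcases le_total k N with hk | hk
    · have := hfar k hk
      omega
    · have := hpos k hk
      omega

lemma measurable_floor_two_pow (k : ℕ) : Measurable fun x : ℝ => ⌊2 ^ k * x⌋ :=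
  (measurable_id.const_mul _).floor

/-- The filtration of the binary digits: at time `k` the first `k` digits are known. -/
noncomputable def dyadicFiltration : Filtration ℕ (inferInstance : MeasurableSpace ℝ) where
  seq k := MeasurableSpace.comap (fun x : ℝ => ⌊2 ^ k * x⌋) ⊤
  mono' := by
    refine monotone_nat_of_le_succ fun k => ?_
    rintro _ ⟨S, -, rfl⟩
    refine ⟨(· / 2) ⁻¹' S, trivial, ?_⟩
    ext x
    simp [floor_two_pow_succ_ediv]
  le' k := (measurable_floor_two_pow k).comap_le

lemma stronglyAdapted_Dfun (r : ℕ → ℝ) : StronglyAdapted dyadicFiltration (Dfun r) := by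
  intro k
  have h : Dfun r k = (fun c : ℤ => Dfun r k ((c : ℝ) / 2 ^ k)) ∘ fun x : ℝ => ⌊2 ^ k * x⌋ := by
    ext x
    exact (Dfun_floor r le_rfl x).symm
  have hm : Measurable[dyadicFiltration k] (Dfun r k) := by
    rw [h]
    exact Measurable.comp measurable_from_top (comap_measurable _)
  exact hm.stronglyMeasurable

lemma eps_eq_ite (j : ℕ) (x : ℝ) :
    (-1 : ℝ) ^ eps j x = if ⌊2 ^ j * x⌋ % 2 = 0 then 1 else -1 := by
  unfold eps
  rcases Int.emod_two_eq_zero_or_one ⌊2 ^ j * x⌋ with h | h <;> simp [h]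

lemma floor_two_pow_mem_Ico {k : ℕ} {x : ℝ} :
    ⌊2 ^ k * x⌋ ∈ Set.Ico (0 : ℤ) (2 ^ k) ↔ x ∈ Set.Ico (0 : ℝ) 1 := by
  have h : (0 : ℝ) < 2 ^ k := by positivity
  rw [Set.mem_Ico, Set.mem_Ico, Int.floor_nonneg, Int.floor_lt]
  push_cast
  rw [mul_nonneg_iff_of_pos_left h, mul_lt_iff_lt_one_right h]

/-- The next digit is unbiased on every set determined by the earlier ones. -/
lemma setIntegral_neg_one_pow_eps (k : ℕ) (S : Set ℤ) :
    ∫ x in (fun x : ℝ => ⌊2 ^ k * x⌋) ⁻¹' S ∩ Set.Ico 0 1, (-1 : ℝ) ^ eps (k + 1) x = 0 := by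
  set A : Set ℝ := (fun x : ℝ => ⌊2 ^ k * x⌋) ⁻¹' S ∩ Set.Ico 0 1 with hA
  have hAm : MeasurableSet A := (measurable_floor_two_pow k trivial).inter measurableSet_Ico
  set B : Set ℝ := A ∩ (fun x : ℝ => ⌊2 ^ (k + 1) * x⌋) ⁻¹' {z | z % 2 = 0} with hB
  have hBm : MeasurableSet B := hAm.inter (measurable_floor_two_pow (k + 1) trivial)
  have hBfin : volume B ≠ ⊤ := by
    refine ne_top_of_le_ne_top (b := volume (Set.Ico (0 : ℝ) 1)) (by simp) (measure_mono ?_)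
    exact fun x hx => hx.1.2
  set G : ℝ → ℝ := B.indicator 1 with hG
  have hGi : Integrable G := (integrable_indicator_iff hBm).2 (integrableOn_const hBfin)
  set δ : ℝ := 1 / 2 ^ (k + 1) with hδ
  have key : A.indicator (fun x => (-1 : ℝ) ^ eps (k + 1) x) = fun x => G x - G (x - δ) := by
    have memA (x : ℝ) : x ∈ A ↔ ⌊2 ^ (k + 1) * x⌋ / 2 ∈ S ∩ Set.Ico (0 : ℤ) (2 ^ k) := by
      rw [floor_two_pow_succ_ediv, hA, Set.mem_inter_iff, Set.mem_inter_iff, floor_two_pow_mem_Ico]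
      rfl
    have memB (x : ℝ) : x ∈ B ↔ x ∈ A ∧ ⌊2 ^ (k + 1) * x⌋ % 2 = 0 := Iff.rfl
    classical
    ext x
    have hfl : ⌊2 ^ (k + 1) * (x - δ)⌋ = ⌊2 ^ (k + 1) * x⌋ - 1 := by
      rw [← Int.floor_sub_one]
      congr 1
      rw [hδ]
      field_simp
    simp only [hG, Set.indicator_apply, memB, memA, hfl, eps_eq_ite, Pi.one_apply]
    generalize ⌊2 ^ (k + 1) * x⌋ = q
    rcases Int.emod_two_eq_zero_or_one q with h | h
    · have h' : (q - 1) % 2 = 1 := by omega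
      simp [h, h']
    · have h' : (q - 1) % 2 = 0 := by omega
      have h'' : (q - 1) / 2 = q / 2 := by omega
      simp only [h, h', h'']
      split_ifs <;> simp_all
  rw [← integral_indicator hAm, key, integral_sub hGi (hGi.comp_sub_right δ),
    integral_sub_right_eq_self, sub_self]

lemma abs_Dfun_le {r : ℕ → ℝ} (hr : ∀ n, r n = 1 ∨ r n = -1) (k : ℕ) (x : ℝ) :
    |Dfun r k x| ≤ k := by
  obtain ⟨d, hd, h0, hstep⟩ := exists_int_walk hr x
  have h := walk_abs_le h0 hstep k
  rw [← hd, abs_le]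
  exact_mod_cast h

lemma martingale_Dfun {r : ℕ → ℝ} (hr : ∀ n, r n = 1 ∨ r n = -1) :
    Martingale (Dfun r) dyadicFiltration (volume.restrict (Set.Ico (0 : ℝ) 1)) := by
  have hint (k : ℕ) : Integrable (Dfun r k) (volume.restrict (Set.Ico (0 : ℝ) 1)) :=
    Integrable.of_bound
      ((stronglyAdapted_Dfun r k).mono (dyadicFiltration.le k)).aestronglyMeasurable k
      (Filter.Eventually.of_forall fun x => abs_Dfun_le hr k x)
  refine martingale_of_setIntegral_eq_succ (stronglyAdapted_Dfun r) hint ?_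
  rintro k _ ⟨S, -, rfl⟩
  have hm : MeasurableSet ((fun x : ℝ => ⌊2 ^ k * x⌋) ⁻¹' S) :=
    measurable_floor_two_pow k trivial
  rw [← sub_eq_zero, ← integral_sub (hint k).integrableOn (hint (k + 1)).integrableOn]
  simp only [Dfun_succ, sub_add_cancel_left]
  rw [integral_neg, integral_const_mul, Measure.restrict_restrict hm,
    setIntegral_neg_one_pow_eps, mul_zero, neg_zero]

/-- The walk is recurrent: almost surely it vanishes at arbitrarily late times. -/
lemma ae_frequently_Dfun_eq_zero {r : ℕ → ℝ} (hr : ∀ n, r n = 1 ∨ r n = -1) :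
    ∀ᵐ x ∂volume.restrict (Set.Ico (0 : ℝ) 1), ∀ N, ∃ k, N ≤ k ∧ Dfun r k x = 0 := by
  have hstep (x : ℝ) (k : ℕ) : |Dfun r (k + 1) x - Dfun r k x| = 1 := by
    rw [Dfun_succ, add_sub_cancel_left, abs_mul, abs_neg_one_pow, mul_one]
    rcases hr k with h | h <;> simp [h]
  have hbdd : ∀ᵐ x ∂volume.restrict (Set.Ico (0 : ℝ) 1),
      ∀ k, |Dfun r (k + 1) x - Dfun r k x| ≤ (1 : NNReal) :=
    Filter.Eventually.of_forall fun x k => by simp [hstep]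
  filter_upwards [(martingale_Dfun hr).submartingale.bddAbove_iff_exists_tendsto hbdd,
    (martingale_Dfun hr).bddAbove_range_iff_bddBelow_range hbdd] with x h₁ h₂
  have hno : ¬ ∃ c, Filter.Tendsto (fun k => Dfun r k x) Filter.atTop (nhds c) := by
    rintro ⟨c, hc⟩
    have h := ((hc.comp (Filter.tendsto_add_atTop_nat 1)).sub hc).abs
    simp only [Function.comp_def, hstep, sub_self, abs_zero] at h
    exact one_ne_zero (tendsto_nhds_unique tendsto_const_nhds h)
  have hna := mt h₁.1 hno
  have hnb := mt h₂.2 hna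
  by_contra! hcon
  obtain ⟨N, hN⟩ := hcon
  obtain ⟨d, hd, h0, hds⟩ := exists_int_walk hr x
  have hN' (k : ℕ) (hk : N ≤ k) : d k ≠ 0 := by
    intro h
    apply hN k hk
    rw [← hd, h, Int.cast_zero]
  rcases walk_bounded_of_ne_zero h0 hds hN' with h | h
  · refine hnb ⟨-(N : ℝ), ?_⟩
    rintro _ ⟨k, rfl⟩
    simp only [← hd]
    exact_mod_cast h k
  · refine hna ⟨(N : ℝ), ?_⟩
    rintro _ ⟨k, rfl⟩
    simp only [← hd]
    exact_mod_cast h k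

lemma mem_Un_of_frequently {r : ℕ → ℝ} (hr : ∀ n, r n = 1 ∨ r n = -1) {n : ℕ} (hn : 1 ≤ n)
    {x : ℝ} (hx : x ∈ Set.Ico (0 : ℝ) 1) (hz : ∀ N, ∃ k, N ≤ k ∧ Dfun r k x = 0) :
    x ∈ Un r n := by
  classical
  set p : ℕ → Prop := fun j => 1 ≤ j ∧ Dfun r j x = 0 with hp
  have hinf : (Set.ofPred p).Infinite := by
    refine Set.infinite_of_not_bddAbove ?_
    rintro ⟨N, hN⟩
    obtain ⟨k, hk, hk0⟩ := hz (N + 1)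
    have : k ≤ N := hN (show p k from ⟨by omega, hk0⟩)
    omega
  set j := Nat.nth p (n - 1) with hj
  have hpj : p j := Nat.nth_mem_of_infinite hinf _
  have hcount : Nat.count p (j + 1) = n := by
    rw [hj, Nat.count_nth_succ_of_infinite hinf]
    omega
  obtain ⟨d, hd, h0, hds⟩ := exists_int_walk hr x
  have hdj : d j = 0 := by
    have h := hd j
    rw [hpj.2] at h
    exact_mod_cast h
  obtain ⟨m, hm⟩ := even_of_walk_eq_zero h0 hds hdj
  rw [← two_mul] at hm
  have hq := (floor_two_pow_mem_Ico (k := 2 * m)).2 hx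
  obtain ⟨k, hk⟩ := Int.eq_ofNat_of_zero_le hq.1
  have hkR : (k : ℝ) = (⌊2 ^ (2 * m) * x⌋ : ℝ) := by
    rw [hk]
    simp
  have hD (i : ℕ) (hi : i ≤ 2 * m) : Dfun r i ((k : ℝ) / 2 ^ (2 * m)) = Dfun r i x := by
    rw [hkR, Dfun_floor r hi]
  have hpos : (0 : ℝ) < 2 ^ (2 * m) := by positivity
  refine Set.mem_iUnion₂.2 ⟨(k, m), ⟨⟨?_, ?_⟩, ?_⟩, ?_, ?_⟩
  · have h := hq.2
    rw [hk] at h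
    exact_mod_cast h
  · rw [hD _ le_rfl, ← hm]
    exact hpj.2
  · rw [← hcount, Nat.count_eq_card_filter_range, ← Set.ncard_coe_finset]
    unfold generation
    congr 1
    ext i
    simp only [Set.mem_ofPred_eq, Finset.coe_filter, Finset.mem_range, hp]
    constructor
    · rintro ⟨h1, h2, h3⟩
      exact ⟨by omega, h1, by rwa [hD i h2] at h3⟩
    · rintro ⟨h1, h2, h3⟩
      have h4 : i ≤ 2 * m := by omega
      exact ⟨h2, h4, by rwa [hD i h4]⟩
  · change (k : ℝ) / 2 ^ (2 * m) ≤ x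
    rw [div_le_iff₀' hpos, hkR]
    exact Int.floor_le _
  · change x ≤ ((k : ℝ) + 1) / 2 ^ (2 * m)
    rw [le_div_iff₀' hpos, hkR]
    exact (Int.lt_floor_add_one _).le

/-- For each `n ≥ 1`, the union `U_n` of the intervals of the balanced pairs of
generation `n` has full Lebesgue measure in `[0,1]`, and in particular is dense
in `[0,1]`. -/
theorem Un_full_measure_and_dense (r : ℕ → ℝ) (hr : ∀ n, r n = 1 ∨ r n = -1)
    (n : ℕ) (hn : 1 ≤ n) :
    volume (Set.Icc (0 : ℝ) 1 \ Un r n) = 0 ∧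
      Set.Icc (0 : ℝ) 1 ⊆ closure (Un r n) := by
  have hnull : volume (Set.Icc (0 : ℝ) 1 \ Un r n) = 0 := by
    have h := (ae_restrict_iff' measurableSet_Ico).1 (ae_frequently_Dfun_eq_zero hr)
    have hsub : Set.Icc (0 : ℝ) 1 \ Un r n ⊆
        {x | ¬ (x ∈ Set.Ico (0 : ℝ) 1 → ∀ N, ∃ k, N ≤ k ∧ Dfun r k x = 0)} ∪ {1} := by
      rintro x ⟨⟨hx0, hx1⟩, hxU⟩
      rcases hx1.eq_or_lt with rfl | hlt
      · exact Or.inr rfl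
      · exact Or.inl fun hz => hxU (mem_Un_of_frequently hr hn ⟨hx0, hlt⟩ (hz ⟨hx0, hlt⟩))
    exact measure_mono_null hsub (measure_union_null (ae_iff.1 h) (by simp))
  refine ⟨hnull, ?_⟩
  rw [← closure_Ioo (zero_ne_one' ℝ)]
  refine closure_minimal (fun x hx => ?_) isClosed_closure
  by_contra hxU
  have hopen : IsOpen (Set.Ioo (0 : ℝ) 1 ∩ (closure (Un r n))ᶜ) :=
    isOpen_Ioo.inter isClosed_closure.isOpen_compl
  refine (hopen.measure_pos volume ⟨x, hx, hxU⟩).ne' (measure_mono_null ?_ hnull)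
  exact fun y hy => ⟨Set.Ioo_subset_Icc_self hy.1, fun hyU => hy.2 (subset_closure hyU)⟩
end
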